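/- arXiv:2307.10510 — 2 statements merged into one kernel-verified Lean document; each statement's English description precedes it below -/
import Mathlib

section
/- Let G be a graph containing a path on four vertices with edges (v_1, v_2), (v_2, v_3), (v_3, v_4) such that each of v_1, v_2, v_3, v_4 has degree exactly 2 in G. Then G is (P_3, P_4)-good if and only if G − v_2 is (P_3, P_4)-good. -/
/-- `G` contains a path on `n` vertices (as a subgraph). -/
def HasNPath {V : Type*} (G : SimpleGraph V) (n : ℕ) : Prop :=
  ∃ (u w : V) (p : G.Walk u w), p.IsPath ∧ p.length + 1 = n

/-- `v` is an endpoint of a path on `n` vertices in `G`. -/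
def IsPathEndpoint {V : Type*} (G : SimpleGraph V) (v : V) (n : ℕ) : Prop :=
  ∃ (w : V) (p : G.Walk v w), p.IsPath ∧ p.length + 1 = n

/-- `x` is the maximum number of vertices of a path in `G` having `v` as an endpoint;
we then say `v` is a strict endpoint of a `P_x` in `G`. -/
def StrictEndpoint {V : Type*} (G : SimpleGraph V) (v : V) (x : ℕ) : Prop :=
  IsPathEndpoint G v x ∧ ∀ y, IsPathEndpoint G v y → y ≤ x

/-- A red/blue coloring of the edges of `G` is given by its red subgraph `R ≤ G`;
the blue subgraph is `G \ R`.  The coloring is `(P_k, P_ℓ)`-good if the red subgraph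
has no path on `k` vertices and the blue subgraph has no path on `ℓ` vertices. -/
def GoodColoring {V : Type*} (G R : SimpleGraph V) (k ℓ : ℕ) : Prop :=
  R ≤ G ∧ ¬ HasNPath R k ∧ ¬ HasNPath (G \ R) ℓ

/-- `G` is `(P_k, P_ℓ)`-good if it admits at least one `(P_k, P_ℓ)`-good coloring. -/
def IsGood {V : Type*} (G : SimpleGraph V) (k ℓ : ℕ) : Prop :=
  ∃ R : SimpleGraph V, GoodColoring G R k ℓ

theorem hasNPath_three_iff {V : Type*} (G : SimpleGraph V) :
    HasNPath G 3 ↔ ∃ x y z, G.Adj x y ∧ G.Adj y z ∧ x ≠ z := by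
  constructor
  · rintro ⟨u, w, p, hp, hl⟩
    match p with
    | .nil => simp at hl
    | .cons _ .nil => simp at hl
    | .cons h₁ (.cons h₂ .nil) =>
      refine ⟨_, _, _, h₁, h₂, ?_⟩
      simp [SimpleGraph.Walk.cons_isPath_iff] at hp
      tauto
    | .cons _ (.cons _ (.cons _ _)) => simp at hl
  · rintro ⟨x, y, z, h₁, h₂, hne⟩
    refine ⟨x, z, .cons h₁ (.cons h₂ .nil), ?_, rfl⟩
    simp [SimpleGraph.Walk.cons_isPath_iff, h₁.ne, h₂.ne, hne]

theorem hasNPath_four_iff {V : Type*} (G : SimpleGraph V) :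
    HasNPath G 4 ↔ ∃ w x y z, G.Adj w x ∧ G.Adj x y ∧ G.Adj y z ∧ w ≠ y ∧ w ≠ z ∧ x ≠ z := by
  constructor
  · rintro ⟨u, w, p, hp, hl⟩
    match p with
    | .nil => simp at hl
    | .cons _ .nil => simp at hl
    | .cons _ (.cons _ .nil) => simp at hl
    | .cons h₁ (.cons h₂ (.cons h₃ .nil)) =>
      refine ⟨_, _, _, _, h₁, h₂, h₃, ?_⟩
      simp [SimpleGraph.Walk.cons_isPath_iff] at hp
      tauto
    | .cons _ (.cons _ (.cons _ (.cons _ _))) => simp at hl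
  · rintro ⟨w, x, y, z, h₁, h₂, h₃, hwy, hwz, hxz⟩
    refine ⟨w, z, .cons h₁ (.cons h₂ (.cons h₃ .nil)), ?_, rfl⟩
    simp [SimpleGraph.Walk.cons_isPath_iff, h₁.ne, h₂.ne, h₃.ne, hwy, hwz, hxz]

/-- A coloring is `(P_3, P_4)`-good iff red is a matching and no three consecutive blue edges
form a path. -/
theorem goodColoring_three_four_iff {V : Type*} (G R : SimpleGraph V) :
    GoodColoring G R 3 4 ↔ R ≤ G ∧
      (∀ x y z, R.Adj x y → R.Adj y z → x = z) ∧
      ∀ w x y z, (G \ R).Adj w x → (G \ R).Adj x y → (G \ R).Adj y z →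
        w ≠ y → w ≠ z → x = z := by
  simp only [GoodColoring, hasNPath_three_iff, hasNPath_four_iff]
  push Not
  rfl

theorem IsGood.induce {V : Type*} {G : SimpleGraph V} (h : IsGood G 3 4) (s : Set V) :
    IsGood (G.induce s) 3 4 := by
  obtain ⟨R, hR⟩ := h
  rw [goodColoring_three_four_iff] at hR
  obtain ⟨hle, hred, hblue⟩ := hR
  refine ⟨R.induce s, (goodColoring_three_four_iff _ _).2 ⟨?_, ?_, ?_⟩⟩
  · exact fun _ _ h => hle h
  · exact fun x y z hxy hyz => Subtype.ext (hred x y z hxy hyz)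
  · exact fun w x y z hwx hxy hyz hwy hwz => Subtype.ext
      (hblue w x y z hwx hxy hyz (Subtype.coe_ne_coe.2 hwy) (Subtype.coe_ne_coe.2 hwz))

theorem exists_other_neighbor_of_degree_eq_two {V : Type*} [Fintype V] [DecidableEq V]
    {G : SimpleGraph V} [DecidableRel G.Adj] {v u : V} (hd : G.degree v = 2) (h : G.Adj v u) :
    ∃ a, ∀ x, G.Adj v x ↔ x = u ∨ x = a := by
  obtain ⟨b, c, -, hN⟩ := Finset.card_eq_two.1 hd
  have key : ∀ x, G.Adj v x ↔ x = b ∨ x = c := fun x => by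
    rw [← SimpleGraph.mem_neighborFinset, hN]; simp
  rcases (key u).1 h with rfl | rfl
  · exact ⟨c, key⟩
  · exact ⟨b, fun x => (key x).trans or_comm⟩

/-- A good coloring of `G - v₂` extends to `G`, recoloring `v₃v₄` red if necessary. -/
theorem IsGood.of_induce_ne {V : Type*} {G : SimpleGraph V} {v₁ v₂ v₃ v₄ a b : V}
    (h13 : v₁ ≠ v₃) (h14 : v₁ ≠ v₄) (h24 : v₂ ≠ v₄)
    (n1 : ∀ x, G.Adj v₁ x ↔ x = v₂ ∨ x = a) (n2 : ∀ x, G.Adj v₂ x ↔ x = v₁ ∨ x = v₃)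
    (n3 : ∀ x, G.Adj v₃ x ↔ x = v₂ ∨ x = v₄) (n4 : ∀ x, G.Adj v₄ x ↔ x = v₃ ∨ x = b)
    (h : IsGood (G.induce {u | u ≠ v₂}) 3 4) : IsGood G 3 4 := by
  obtain ⟨R', hR'⟩ := h
  rw [goodColoring_three_four_iff] at hR'
  obtain ⟨hle', hred', hblue'⟩ := hR'
  obtain ⟨R, hle, hred, hR2, hblue⟩ : ∃ R : SimpleGraph V, (∀ x y, R.Adj x y → G.Adj x y) ∧
      (∀ x y z, R.Adj x y → R.Adj y z → x = z) ∧ (∀ x, ¬ R.Adj v₂ x) ∧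
      ∀ w x y z, w ≠ v₂ → x ≠ v₂ → y ≠ v₂ → z ≠ v₂ → G.Adj w x → G.Adj x y → G.Adj y z →
        ¬ R.Adj w x → ¬ R.Adj x y → ¬ R.Adj y z → w ≠ y → w ≠ z → x = z := by
    have hR : ∀ x y, (R'.map (Function.Embedding.subtype (· ≠ v₂))).Adj x y ↔
        ∃ (hx : x ≠ v₂) (hy : y ≠ v₂), R'.Adj ⟨x, hx⟩ ⟨y, hy⟩ := by
      intro x y
      rw [SimpleGraph.map_adj]
      constructor
      · rintro ⟨u, v, huv, rfl, rfl⟩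
        exact ⟨u.2, v.2, huv⟩
      · rintro ⟨hx, hy, h⟩
        exact ⟨_, _, h, rfl, rfl⟩
    refine ⟨R'.map (Function.Embedding.subtype (· ≠ v₂)), ?_, ?_, ?_, ?_⟩
    · intro x y h
      obtain ⟨hx, hy, h⟩ := (hR x y).1 h
      exact hle' h
    · intro x y z h₁ h₂
      obtain ⟨hx, hy, h₁⟩ := (hR x y).1 h₁
      obtain ⟨_, hz, h₂⟩ := (hR y z).1 h₂
      exact congrArg Subtype.val (hred' _ _ _ h₁ h₂)
    · intro x h
      exact ((hR _ _).1 h).1 rfl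
    · intro w x y z hw hx hy hz g₁ g₂ g₃ r₁ r₂ r₃ hwy hwz
      refine congrArg Subtype.val (hblue' ⟨w, hw⟩ ⟨x, hx⟩ ⟨y, hy⟩ ⟨z, hz⟩ ⟨g₁, ?_⟩ ⟨g₂, ?_⟩ ⟨g₃, ?_⟩
        (fun h => hwy (congrArg Subtype.val h)) (fun h => hwz (congrArg Subtype.val h)))
      · exact fun h => r₁ ((hR _ _).2 ⟨_, _, h⟩)
      · exact fun h => r₂ ((hR _ _).2 ⟨_, _, h⟩)
      · exact fun h => r₃ ((hR _ _).2 ⟨_, _, h⟩)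
  clear hle' hred' hblue' R'
  have gs : ∀ x y, G.Adj x y → G.Adj y x := fun _ _ h => h.symm
  have rs : ∀ x y, R.Adj x y → R.Adj y x := fun _ _ h => h.symm
  have gi : ∀ x, ¬ G.Adj x x := fun _ => G.loopless.irrefl _
  have hR1 : ∀ x, R.Adj v₁ x → x = a := by grind
  have hR3 : ∀ x, R.Adj v₃ x → x = v₄ := by grind
  have hR4 : ∀ x, R.Adj v₄ x → x = v₃ ∨ x = b := by grind
  have h12 : v₁ ≠ v₂ := ((n1 v₂).2 (.inl rfl)).ne
  have h23 : v₂ ≠ v₃ := ((n2 v₃).2 (.inr rfl)).ne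
  have h34 : v₃ ≠ v₄ := ((n3 v₄).2 (.inr rfl)).ne
  by_cases r1 : R.Adj v₁ a
  · by_cases r3 : R.Adj v₃ v₄
    · refine ⟨R, (goodColoring_three_four_iff _ _).2 ⟨hle, hred, ?_⟩⟩
      simp only [SimpleGraph.sdiff_adj]
      intro w x y z
      by_cases w = v₂ <;> by_cases x = v₂ <;> by_cases y = v₂ <;> by_cases z = v₂ <;> grind
    · refine ⟨R ⊔ SimpleGraph.edge v₂ v₃, (goodColoring_three_four_iff _ _).2 ⟨?_, ?_, ?_⟩⟩
      · intro x y
        simp only [SimpleGraph.sup_adj, SimpleGraph.edge_adj]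
        grind
      · simp only [SimpleGraph.sup_adj, SimpleGraph.edge_adj]
        grind
      · simp only [SimpleGraph.sdiff_adj, SimpleGraph.sup_adj, SimpleGraph.edge_adj]
        intro w x y z
        by_cases w = v₂ <;> by_cases x = v₂ <;> by_cases y = v₂ <;> by_cases z = v₂ <;> grind
  · by_cases r3 : R.Adj v₃ v₄ ∨ R.Adj v₄ b
    · refine ⟨R ⊔ SimpleGraph.edge v₁ v₂, (goodColoring_three_four_iff _ _).2 ⟨?_, ?_, ?_⟩⟩
      · intro x y
        simp only [SimpleGraph.sup_adj, SimpleGraph.edge_adj]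
        grind
      · simp only [SimpleGraph.sup_adj, SimpleGraph.edge_adj]
        grind
      · simp only [SimpleGraph.sdiff_adj, SimpleGraph.sup_adj, SimpleGraph.edge_adj]
        intro w x y z
        by_cases w = v₂ <;> by_cases x = v₂ <;> by_cases y = v₂ <;> by_cases z = v₂ <;> grind
    · refine ⟨R ⊔ SimpleGraph.edge v₁ v₂ ⊔ SimpleGraph.edge v₃ v₄,
        (goodColoring_three_four_iff _ _).2 ⟨?_, ?_, ?_⟩⟩
      · intro x y
        simp only [SimpleGraph.sup_adj, SimpleGraph.edge_adj]
        grind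
      · simp only [SimpleGraph.sup_adj, SimpleGraph.edge_adj]
        grind
      · simp only [SimpleGraph.sdiff_adj, SimpleGraph.sup_adj, SimpleGraph.edge_adj]
        intro w x y z
        by_cases w = v₂ <;> by_cases x = v₂ <;> by_cases y = v₂ <;> by_cases z = v₂ <;> grind

/-- if G has a path on four vertices v₁v₂v₃v₄ each of degree exactly 2,
then G is (P_3,P_4)-good iff G - v₂ is (P_3,P_4)-good. -/
theorem stmt2 {V : Type*} [Fintype V] [DecidableEq V] (G : SimpleGraph V)
    [DecidableRel G.Adj] (v₁ v₂ v₃ v₄ : V)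
    (h13 : v₁ ≠ v₃) (h14 : v₁ ≠ v₄) (h24 : v₂ ≠ v₄)
    (e12 : G.Adj v₁ v₂) (e23 : G.Adj v₂ v₃) (e34 : G.Adj v₃ v₄)
    (d1 : G.degree v₁ = 2) (d2 : G.degree v₂ = 2)
    (d3 : G.degree v₃ = 2) (d4 : G.degree v₄ = 2) :
    IsGood G 3 4 ↔ IsGood (G.induce {u | u ≠ v₂}) 3 4 := by
  obtain ⟨a, n1⟩ := exists_other_neighbor_of_degree_eq_two d1 e12
  obtain ⟨c, n2⟩ := exists_other_neighbor_of_degree_eq_two d2 e12.symm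
  obtain ⟨d, n3⟩ := exists_other_neighbor_of_degree_eq_two d3 e23.symm
  obtain ⟨b, n4⟩ := exists_other_neighbor_of_degree_eq_two d4 e34.symm
  obtain rfl : v₃ = c := ((n2 v₃).1 e23).resolve_left h13.symm
  obtain rfl : v₄ = d := ((n3 v₄).1 e34).resolve_left h24.symm
  exact ⟨fun h => h.induce _, IsGood.of_induce_ne h13 h14 h24 n1 n2 n3 n4⟩
end

section
/- For all integers k, ℓ, x with 3 ≤ k < ℓ (and ℓ ≥ 5 in case k = 3) and 2 ≤ x ≤ ℓ−1, there exists a (k, ℓ, x)-blue-transmitter; that is, a (P_k, P_ℓ)-good graph G with a vertex v such that in every (P_k, P_ℓ)-good coloring of G, v is a strict endpoint of a blue P_x and v is incident to no red edge. -/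
section PathLists

open scoped Classical

/-- The list `l` traverses a path of `H` all of whose vertices lie in `A`. -/
def IsPathIn {V : Type*} (H : SimpleGraph V) (A : Finset V) (l : List V) : Prop :=
  l.IsChain H.Adj ∧ l.Nodup ∧ ∀ x ∈ l, x ∈ A

/-- Every path of `H` inside `A` has at most `m` vertices. -/
def PathsLE {V : Type*} (H : SimpleGraph V) (A : Finset V) (m : ℕ) : Prop :=
  ∀ l, IsPathIn H A l → l.length ≤ m

/-- The number of neighbours of `z` in `A`. -/
noncomputable def degIn {V : Type*} (H : SimpleGraph V) (A : Finset V) (z : V) : ℕ :=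
  (A.filter (H.Adj z)).card

/-- The sum of the degrees of the graph induced by `H` on `A`. -/
noncomputable def degSum {V : Type*} (H : SimpleGraph V) (A : Finset V) : ℕ :=
  ∑ z ∈ A, degIn H A z

variable {V : Type*} {H : SimpleGraph V} {A : Finset V}

lemma IsPathIn.mono {B : Finset V} {l : List V} (h : IsPathIn H B l) (hBA : B ⊆ A) :
    IsPathIn H A l := ⟨h.1, h.2.1, fun x hx => hBA (h.2.2 x hx)⟩

lemma PathsLE.mono {B : Finset V} {m : ℕ} (h : PathsLE H A m) (hBA : B ⊆ A) : PathsLE H B m :=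
  fun l hl => h l (hl.mono hBA)

lemma IsPathIn.reverse {l : List V} (h : IsPathIn H A l) : IsPathIn H A l.reverse := by
  refine ⟨?_, List.nodup_reverse.2 h.2.1, fun x hx => h.2.2 x (List.mem_reverse.1 hx)⟩
  rw [List.isChain_reverse]
  exact h.1.imp fun a b hab => hab.symm

lemma IsPathIn.cons {y z : V} {l : List V} (h : IsPathIn H A (y :: l)) (hz : z ∈ A)
    (hzl : z ∉ y :: l) (hzy : H.Adj z y) : IsPathIn H A (z :: y :: l) := by
  refine ⟨List.isChain_cons_cons.2 ⟨hzy, h.1⟩, List.nodup_cons.2 ⟨hzl, h.2.1⟩, ?_⟩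
  intro x hx
  rcases List.mem_cons.1 hx with rfl | hx
  · exact hz
  · exact h.2.2 x hx

lemma IsPathIn.take {l : List V} (h : IsPathIn H A l) (n : ℕ) : IsPathIn H A (l.take n) :=
  ⟨h.1.take n, h.2.1.sublist (List.take_sublist n l), fun x hx => h.2.2 x (List.mem_of_mem_take hx)⟩

/-- A path whose ends satisfy Ore's condition on the path itself can be closed up to a cycle. -/
lemma exists_crossing {l : List V} {y w : V} (hy : l.head? = some y) (hw : l.getLast? = some w)
    (hyl : ∀ u ∈ A, H.Adj y u → u ∈ l) (hwl : ∀ u ∈ A, H.Adj w u → u ∈ l)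
    (hdeg : l.length ≤ degIn H A y + degIn H A w) :
    ∃ l₁ l₂ : List V, ∃ s t : V, l = l₁ ++ l₂ ∧ l₁.getLast? = some s ∧ l₂.head? = some t ∧
      H.Adj y t ∧ H.Adj w s := by
  set f : ℕ → V := fun i => l.getD i y with hf
  have hpos : 0 < l.length := by
    cases l with
    | nil => simp at hy
    | cons => simp
  have hf0 : f 0 = y := by
    cases l with
    | nil => simp at hy
    | cons => simpa [hf] using hy
  have hfl : f (l.length - 1) = w := by
    rw [List.getLast?_eq_getElem?] at hw
    simp [hf, List.getD, hw]
  have hmem : ∀ u ∈ l, ∃ i < l.length, f i = u := by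
    intro u hu
    obtain ⟨i, hi, rfl⟩ := List.mem_iff_getElem.1 hu
    exact ⟨i, hi, by simp [hf, hi]⟩
  set I := (Finset.range (l.length - 1)).filter fun i => H.Adj y (f (i + 1)) with hI
  set J := (Finset.range (l.length - 1)).filter fun i => H.Adj w (f i) with hJ
  have hIc : degIn H A y ≤ I.card := by
    refine le_trans (Finset.card_le_card ?_) (Finset.card_image_le (f := fun i => f (i + 1)))
    intro u hu
    obtain ⟨huA, hyu⟩ := Finset.mem_filter.1 hu
    obtain ⟨i, hi, rfl⟩ := hmem u (hyl u huA hyu)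
    rcases i with _ | i
    · exact absurd hyu (by simp [hf0])
    · exact Finset.mem_image.2 ⟨i, Finset.mem_filter.2 ⟨Finset.mem_range.2 (by omega), hyu⟩, rfl⟩
  have hJc : degIn H A w ≤ J.card := by
    refine le_trans (Finset.card_le_card ?_) (Finset.card_image_le (f := f))
    intro u hu
    obtain ⟨huA, hwu⟩ := Finset.mem_filter.1 hu
    obtain ⟨i, hi, rfl⟩ := hmem u (hwl u huA hwu)
    have : i ≠ l.length - 1 := by
      rintro rfl
      rw [hfl] at hwu
      exact H.loopless.irrefl _ hwu
    exact Finset.mem_image.2 ⟨i, Finset.mem_filter.2 ⟨Finset.mem_range.2 (by omega), hwu⟩, rfl⟩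
  have hne : (I ∩ J).Nonempty := by
    rw [← Finset.card_pos]
    have h1 := Finset.card_union_add_card_inter I J
    have h2 : (I ∪ J).card ≤ l.length - 1 := by
      calc (I ∪ J).card ≤ (Finset.range (l.length - 1)).card :=
            Finset.card_le_card (Finset.union_subset (Finset.filter_subset _ _)
              (Finset.filter_subset _ _))
        _ = _ := Finset.card_range _
    omega
  obtain ⟨i, hi⟩ := hne
  simp only [hI, hJ, Finset.mem_inter, Finset.mem_filter, Finset.mem_range] at hi
  obtain ⟨⟨hil, hyi⟩, -, hwi⟩ := hi
  refine ⟨l.take (i + 1), l.drop (i + 1), f i, f (i + 1), (List.take_append_drop _ _).symm,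
    ?_, ?_, hyi, hwi⟩
  · rw [List.getLast?_take]
    have : i < l.length := by omega
    simp [hf, this]
  · rw [List.head?_drop]
    have : i + 1 < l.length := by omega
    simp [hf, this]

/-- A longest path whose ends satisfy Ore's condition can be rotated to start at any of its
vertices. -/
lemma exists_rotation {l : List V} {y w : V} (hl : IsPathIn H A l)
    (hmax : ∀ l', IsPathIn H A l' → l'.length ≤ l.length)
    (hy : l.head? = some y) (hw : l.getLast? = some w)
    (hdeg : l.length ≤ degIn H A y + degIn H A w) (z : V) (hz : z ∈ l) :
    ∃ l', IsPathIn H A (z :: l') ∧ (z :: l').Perm l := by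
  have key : ∀ l : List V, ∀ y : V, IsPathIn H A l →
      (∀ l', IsPathIn H A l' → l'.length ≤ l.length) → l.head? = some y →
      ∀ u ∈ A, H.Adj y u → u ∈ l := by
    intro l y hl hmax hy u hu hyu
    by_contra hul
    cases l with
    | nil => simp at hy
    | cons a l =>
      simp only [List.head?_cons, Option.some.injEq] at hy
      subst hy
      have := hmax _ (hl.cons hu hul hyu.symm)
      simp at this
  obtain ⟨l₁, l₂, s, t, rfl, hs, ht, hyt, hws⟩ := exists_crossing hy hw (key l y hl hmax hy)
    (fun u hu hwu => List.mem_reverse.1 (key l.reverse w hl.reverse (by simpa using hmax)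
      (by simpa using hw) u hu hwu)) hdeg
  have hl₁ : l₁ ≠ [] := by rintro rfl; simp at hs
  have hl₂ : l₂ ≠ [] := by rintro rfl; simp at ht
  have hy' : l₁.head? = some y := by
    rwa [List.head?_append_of_ne_nil _ hl₁] at hy
  have hw' : l₂.getLast? = some w := by
    rwa [List.getLast?_append_of_ne_nil _ hl₂] at hw
  have hperm : (l₁ ++ l₂.reverse).Perm (l₁ ++ l₂) := (List.reverse_perm l₂).append_left l₁
  have hc : IsPathIn H A (l₁ ++ l₂.reverse) := by
    refine ⟨?_, hperm.nodup_iff.2 hl.2.1, fun x hx => hl.2.2 x (hperm.mem_iff.1 hx)⟩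
    rw [List.isChain_append]
    refine ⟨hl.1.left_of_append, ?_, ?_⟩
    · rw [List.isChain_reverse]
      exact hl.1.right_of_append.imp fun a b hab => hab.symm
    · intro p hp q hq
      rw [hs] at hp
      rw [List.head?_reverse, hw'] at hq
      obtain rfl := Option.some.inj hp
      obtain rfl := Option.some.inj hq
      exact hws.symm
  obtain ⟨p, q, hpq⟩ := List.append_of_mem (hperm.mem_iff.2 hz)
  have hperm' : (z :: q ++ p).Perm (l₁ ++ l₂.reverse) := by
    rw [hpq]; exact List.perm_append_comm
  refine ⟨q ++ p, ⟨?_, ?_, ?_⟩, hperm'.trans hperm⟩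
  · have hc1 := hc.1
    rw [hpq] at hc1
    rw [← List.cons_append, List.isChain_append]
    refine ⟨hc1.right_of_append, hc1.left_of_append, ?_⟩
    intro a ha b hb
    have h1 : (l₁ ++ l₂.reverse).getLast? = some t := by
      rw [List.getLast?_append_of_ne_nil _ (by simpa using hl₂), List.getLast?_reverse, ht]
    rw [hpq, List.getLast?_append_of_ne_nil _ (by simp)] at h1
    have h2 : (l₁ ++ l₂.reverse).head? = some y := by
      rw [List.head?_append_of_ne_nil _ hl₁, hy']
    have hp : p ≠ [] := by rintro rfl; simp at hb
    rw [hpq, List.head?_append_of_ne_nil _ hp] at h2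
    rw [h1] at ha
    rw [h2] at hb
    obtain rfl := Option.some.inj ha
    obtain rfl := Option.some.inj hb
    exact hyt.symm
  · exact hperm'.nodup_iff.2 hc.2.1
  · intro x hx
    exact hc.2.2 x (hperm'.mem_iff.1 hx)

/-- In a graph without paths on `d + 2` vertices, either there is a vertex of small degree outside
a prescribed set `S` of vertices that start no path on `d + 1` vertices, or some `d + 1` vertices
form a union of components each of whose vertices starts a path on `d + 1` vertices, or there is
no path on `d + 1` vertices at all. -/
lemma low_degree_or_closed {d : ℕ} (S : Set V) (hA : PathsLE H A (d + 1))
    (hS : ∀ s ∈ S, ∀ l, IsPathIn H A (s :: l) → l.length ≠ d) :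
    (∃ z ∈ A, z ∉ S ∧ 2 * degIn H A z ≤ d) ∨
    (∃ Y ⊆ A, Y.card = d + 1 ∧ (∀ z ∈ Y, ∃ l, IsPathIn H A (z :: l) ∧ l.length = d) ∧
      ∀ z ∈ Y, ∀ u ∈ A, H.Adj z u → u ∈ Y) ∨ PathsLE H A d := by
  by_cases h1 : ∃ z ∈ A, z ∉ S ∧ 2 * degIn H A z ≤ d
  · exact Or.inl h1
  by_cases h3 : PathsLE H A d
  · exact Or.inr (Or.inr h3)
  refine Or.inr (Or.inl ?_)
  push Not at h1
  simp only [PathsLE, not_forall, not_le] at h3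
  obtain ⟨l, hl, hdl⟩ := h3
  have hlen : l.length = d + 1 := le_antisymm (hA l hl) hdl
  have hhead : ∀ l : List V, IsPathIn H A l → l.length = d + 1 →
      ∃ y, l.head? = some y ∧ d < 2 * degIn H A y := by
    intro l hl hlen
    cases l with
    | nil => simp at hlen
    | cons y l =>
      refine ⟨y, rfl, h1 y (hl.2.2 y (by simp)) fun hyS => hS y hyS l hl ?_⟩
      simpa using hlen
  obtain ⟨y, hy, hyd⟩ := hhead l hl hlen
  obtain ⟨w, hw, hwd⟩ := hhead l.reverse hl.reverse (by simpa using hlen)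
  rw [List.head?_reverse] at hw
  have hrot := exists_rotation hl (fun l' hl' => hlen ▸ hA l' hl') hy hw (by omega)
  refine ⟨l.toFinset, ?_, ?_, ?_, ?_⟩
  · intro x hx
    exact hl.2.2 x (List.mem_toFinset.1 hx)
  · rw [List.toFinset_card_of_nodup hl.2.1, hlen]
  · intro z hz
    obtain ⟨l', hl', hp⟩ := hrot z (List.mem_toFinset.1 hz)
    refine ⟨l', hl', ?_⟩
    have := hp.length_eq
    simp only [List.length_cons] at this
    omega
  · intro z hz u hu hzu
    obtain ⟨l', hl', hp⟩ := hrot z (List.mem_toFinset.1 hz)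
    by_contra hul
    have hul' : u ∉ z :: l' := fun h => hul (List.mem_toFinset.2 (hp.mem_iff.1 h))
    have h2 := hA _ (hl'.cons hu hul' hzu.symm)
    have h3 := hp.length_eq
    simp only [List.length_cons] at h2 h3
    omega

lemma degIn_lt {z : V} (hz : z ∈ A) : degIn H A z < A.card := by
  refine Finset.card_lt_card (Finset.filter_ssubset.2 ⟨z, hz, H.loopless.irrefl z⟩)

lemma degSum_add_card_le : degSum H A + A.card ≤ A.card * A.card := by
  calc degSum H A + A.card = ∑ z ∈ A, (degIn H A z + 1) := by
        rw [Finset.sum_add_distrib]; simp [degSum]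
    _ ≤ ∑ _z ∈ A, A.card := Finset.sum_le_sum fun z hz => degIn_lt hz
    _ = _ := by simp

lemma degIn_erase {z : V} (hz : z ∈ A) (x : V) :
    degIn H A x = degIn H (A.erase z) x + if H.Adj x z then 1 else 0 := by
  unfold degIn
  rw [Finset.filter_erase]
  split_ifs with h
  · exact (Finset.card_erase_add_one (Finset.mem_filter.2 ⟨hz, h⟩)).symm
  · rw [Finset.erase_eq_of_notMem (by simp [h]), add_zero]

lemma degSum_erase {z : V} (hz : z ∈ A) :
    degSum H A = degSum H (A.erase z) + 2 * degIn H A z := by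
  have h1 : degIn H A z = ∑ x ∈ A.erase z, if H.Adj x z then 1 else 0 := by
    rw [degIn_erase hz z, if_neg (H.loopless.irrefl z), add_zero, degIn, Finset.card_filter]
    simp only [H.adj_comm z]
  calc degSum H A = degIn H A z + ∑ x ∈ A.erase z, degIn H A x :=
        (Finset.add_sum_erase A _ hz).symm
    _ = degIn H A z + (degSum H (A.erase z) + degIn H A z) := by
        rw [Finset.sum_congr rfl fun x _ => degIn_erase hz x, Finset.sum_add_distrib, ← h1]; rfl
    _ = _ := by ring

lemma degIn_closed {Y : Finset V} (hYA : Y ⊆ A) (hY : ∀ z ∈ Y, ∀ u ∈ A, H.Adj z u → u ∈ Y)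
    {z : V} (hz : z ∈ Y) : degIn H A z = degIn H Y z := by
  unfold degIn
  congr 1
  ext u
  simp only [Finset.mem_filter]
  exact ⟨fun h => ⟨hY z hz u h.1 h.2, h.2⟩, fun h => ⟨hYA h.1, h.2⟩⟩

lemma degIn_sdiff_closed {Y : Finset V} (hY : ∀ z ∈ Y, ∀ u ∈ A, H.Adj z u → u ∈ Y)
    {z : V} (hz : z ∈ A \ Y) : degIn H A z = degIn H (A \ Y) z := by
  rw [Finset.mem_sdiff] at hz
  unfold degIn
  congr 1
  ext u
  simp only [Finset.mem_filter, Finset.mem_sdiff]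
  exact ⟨fun h => ⟨⟨h.1, fun hu => hz.2 (hY u hu z hz.1 h.2.symm)⟩, h.2⟩,
    fun h => ⟨h.1.1, h.2⟩⟩

lemma degSum_closed {Y : Finset V} (hYA : Y ⊆ A) (hY : ∀ z ∈ Y, ∀ u ∈ A, H.Adj z u → u ∈ Y) :
    degSum H A = degSum H (A \ Y) + degSum H Y := by
  unfold degSum
  rw [← Finset.sum_sdiff hYA, Finset.sum_congr rfl fun z hz => degIn_sdiff_closed hY hz,
    Finset.sum_congr (rfl : Y = Y) fun z hz => degIn_closed hYA hY hz]

lemma degSum_le_of_card_eq {Y : Finset V} {d : ℕ} (hY : Y.card = d + 1) :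
    degSum H Y ≤ d * (d + 1) := by
  have := degSum_add_card_le (H := H) (A := Y)
  rw [hY] at this
  nlinarith

lemma card_sdiff_add {Y : Finset V} {d : ℕ} (hYA : Y ⊆ A) (hY : Y.card = d + 1) :
    (A \ Y).card + (d + 1) = A.card := by
  rw [← hY]; exact Finset.card_sdiff_add_card_eq_card hYA

/-- **Erdős–Gallai**: a graph on `n` vertices without paths on `d + 2` vertices has at most
`d * n / 2` edges. -/
theorem degSum_le_of_pathsLE (d : ℕ) (A : Finset V) (hA : PathsLE H A (d + 1)) :
    degSum H A ≤ d * A.card := by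
  induction d generalizing A with
  | zero =>
    rw [Nat.zero_mul, Nat.le_zero, degSum, Finset.sum_eq_zero_iff]
    intro z hz
    rw [degIn, Finset.card_eq_zero, Finset.filter_eq_empty_iff]
    intro u hu hzu
    have hp : IsPathIn H A [u] := ⟨List.isChain_singleton u, List.nodup_singleton u, by simpa⟩
    have := hA _ (hp.cons hz (by simpa using hzu.ne) hzu)
    simp at this
  | succ d ihd =>
    induction hn : A.card using Nat.strong_induction_on generalizing A with
    | _ n ih =>
      rcases low_degree_or_closed ∅ hA (by simp) with
        ⟨z, hz, -, hzd⟩ | ⟨Y, hYA, hYc, -, hY⟩ | hA'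
      · have hc := Finset.card_erase_add_one hz
        have := ih _ (by omega) (A.erase z) (hA.mono (Finset.erase_subset _ _)) rfl
        rw [degSum_erase hz]
        rw [← hn, ← hc]
        linarith
      · have hc := card_sdiff_add hYA hYc
        have h1 := ih _ (by omega) (A \ Y) (hA.mono Finset.sdiff_subset) rfl
        have h2 := degSum_le_of_card_eq (H := H) hYc
        rw [degSum_closed hYA hY, ← hn, ← hc]
        linarith
      · have := ihd A hA'
        rw [← hn]
        linarith

/-- The Erdős–Gallai bound improves if some vertex starts no path on `d + 1` vertices. -/
lemma degSum_add_le {d : ℕ} (hd : 1 ≤ d) (A : Finset V) (hA : PathsLE H A (d + 1)) {v : V}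
    (hv : v ∈ A) (hvd : ∀ l, IsPathIn H A (v :: l) → l.length ≠ d) :
    degSum H A + d ≤ d * A.card := by
  induction hn : A.card using Nat.strong_induction_on generalizing A with
  | _ n ih =>
    rcases low_degree_or_closed {v} hA (by simpa using hvd) with
      ⟨z, hz, hzv, hzd⟩ | ⟨Y, hYA, hYc, hYp, hY⟩ | hA'
    · have hc := Finset.card_erase_add_one hz
      have := ih _ (by omega) (A.erase z) (hA.mono (Finset.erase_subset _ _))
        (Finset.mem_erase.2 ⟨fun h => hzv h.symm, hv⟩)
        (fun l hl => hvd l (hl.mono (Finset.erase_subset _ _))) rfl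
      rw [degSum_erase hz, ← hn, ← hc]
      linarith
    · have hc := card_sdiff_add hYA hYc
      have hvY : v ∉ Y := fun h => by
        obtain ⟨l, hl, hld⟩ := hYp v h
        exact hvd l hl hld
      have h1 := ih _ (by omega) (A \ Y) (hA.mono Finset.sdiff_subset)
        (Finset.mem_sdiff.2 ⟨hv, hvY⟩) (fun l hl => hvd l (hl.mono Finset.sdiff_subset)) rfl
      have h2 := degSum_le_of_card_eq (H := H) hYc
      rw [degSum_closed hYA hY, ← hn, ← hc]
      linarith
    · obtain ⟨e, rfl⟩ := Nat.exists_eq_add_of_le' hd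
      have h1 := degSum_le_of_pathsLE e A hA'
      have h2 := degSum_add_card_le (H := H) (A := A)
      have h3 : 0 < A.card := Finset.card_pos.2 ⟨v, hv⟩
      rw [hn] at h1 h2 h3
      rcases le_or_gt n (e + 1) with h | h
      · obtain ⟨m, rfl⟩ := Nat.exists_eq_add_of_le' h3
        nlinarith
      · nlinarith

lemma dvd_card_of_lt_degSum {d : ℕ} (hd : 1 ≤ d) (A : Finset V) (hA : PathsLE H A (d + 1))
    (hlt : d * A.card < degSum H A + d) : d + 1 ∣ A.card := by
  induction hn : A.card using Nat.strong_induction_on generalizing A with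
  | _ n ih =>
    rcases low_degree_or_closed ∅ hA (by simp) with
      ⟨z, hz, -, hzd⟩ | ⟨Y, hYA, hYc, -, hY⟩ | hA'
    · exfalso
      have hc := Finset.card_erase_add_one hz
      have hE : PathsLE H (A.erase z) (d + 1) := hA.mono (Finset.erase_subset _ _)
      have h1 := degSum_erase (H := H) hz
      have h2 := degSum_le_of_pathsLE d _ hE
      have hdeg : degIn H A z ≠ 0 := by
        intro h0
        rw [h0] at h1
        rw [← hc] at hlt
        linarith
      obtain ⟨y, hy⟩ := Finset.card_ne_zero.1 hdeg
      obtain ⟨hyA, hzy⟩ := Finset.mem_filter.1 hy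
      have hyE : y ∈ A.erase z := Finset.mem_erase.2 ⟨hzy.ne', hyA⟩
      have h3 := mt (degSum_add_le hd _ hE hyE) (by rw [← hc] at hlt; linarith)
      push Not at h3
      obtain ⟨l, hl, hld⟩ := h3
      have := hA _ ((hl.mono (Finset.erase_subset _ _)).cons hz
        (fun h => by simpa using hl.2.2 z h) hzy)
      simp only [List.length_cons] at this
      omega
    · have hc := card_sdiff_add hYA hYc
      have h2 := degSum_le_of_card_eq (H := H) hYc
      have := ih _ (by omega) (A \ Y) (hA.mono Finset.sdiff_subset)
        (by rw [degSum_closed hYA hY, ← hc] at hlt; linarith) rfl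
      rw [← hn, ← hc]
      exact this.add (dvd_refl _)
    · obtain ⟨e, rfl⟩ := Nat.exists_eq_add_of_le' hd
      have h1 := degSum_le_of_pathsLE e A hA'
      have h2 := degSum_add_card_le (H := H) (A := A)
      rw [hn] at h1 h2 hlt
      rcases Nat.eq_zero_or_pos n with rfl | h3
      · simp
      · exfalso
        obtain ⟨m, rfl⟩ := Nat.exists_eq_add_of_le' h3
        have : m < e + 1 := by nlinarith
        nlinarith

lemma adj_of_degSum_ge (hA : A.card * A.card ≤ degSum H A + A.card) :
    ∀ y ∈ A, ∀ z ∈ A, y ≠ z → H.Adj y z := by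
  intro y hy z hz hyz
  by_contra h
  have hlt : degIn H A y + 1 < A.card := by
    have hsub : insert y (A.filter (H.Adj y)) ⊂ A := by
      refine Finset.ssubset_iff_subset_ne.2 ⟨Finset.insert_subset hy (Finset.filter_subset _ _),
        fun he => ?_⟩
      rw [← he] at hz
      simp [h, hyz.symm] at hz
    have := Finset.card_lt_card hsub
    rwa [Finset.card_insert_of_notMem (by simp)] at this
  have hs : ∑ z ∈ A, (degIn H A z + 1) < ∑ _z ∈ A, A.card :=
    Finset.sum_lt_sum (fun z hz => degIn_lt hz) ⟨y, hy, hlt⟩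
  rw [Finset.sum_add_distrib] at hs
  simp only [Finset.sum_const, smul_eq_mul, mul_one] at hs
  exact absurd hA (not_le.2 hs)

/-- Structure of the graphs attaining equality in `degSum_add_le`. -/
lemma structure_of_degSum_add_ge {d : ℕ} (hd : 3 ≤ d) (A : Finset V)
    (hA : PathsLE H A (d + 1)) {v : V}
    (hv : v ∈ A) (hvd : ∀ l, IsPathIn H A (v :: l) → l.length ≠ d)
    (hge : d * A.card ≤ degSum H A + d) :
    ∀ z ∈ A, z ≠ v →
      (H.Adj v z → ∃ l, IsPathIn H A (z :: l) ∧ (z :: l).getLast? = some v ∧ l.length + 1 = d) ∧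
      (¬ H.Adj v z → d ≤ degIn H A z ∧ ∃ l, IsPathIn H A (z :: l) ∧ l.length = d) := by
  induction hn : A.card using Nat.strong_induction_on generalizing A with
  | _ n ih =>
    rcases low_degree_or_closed {v} hA (by simpa using hvd) with
      ⟨z, hz, hzv, hzd⟩ | ⟨Y, hYA, hYc, hYp, hY⟩ | hA'
    · exfalso
      have hc := Finset.card_erase_add_one hz
      have hE : PathsLE H (A.erase z) (d + 1) := hA.mono (Finset.erase_subset _ _)
      have hvE : v ∈ A.erase z := Finset.mem_erase.2 ⟨fun h => hzv h.symm, hv⟩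
      have hvdE : ∀ l, IsPathIn H (A.erase z) (v :: l) → l.length ≠ d :=
        fun l hl => hvd l (hl.mono (Finset.erase_subset _ _))
      have h1 := degSum_erase (H := H) hz
      have h2 := degSum_add_le (by omega) _ hE hvE hvdE
      have hge' : d * (A.erase z).card ≤ degSum H (A.erase z) + d := by
        rw [← hc] at hge; linarith
      have hdeg : 1 < degIn H A z := by
        rw [← hc] at hge
        by_contra h
        have : 2 * degIn H A z ≤ 2 := by omega
        linarith
      obtain ⟨y, hy, hyv⟩ := Finset.exists_mem_ne hdeg v
      obtain ⟨hyA, hzy⟩ := Finset.mem_filter.1 hy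
      have hyE : y ∈ A.erase z := Finset.mem_erase.2 ⟨hzy.ne', hyA⟩
      obtain ⟨h3, h4⟩ := ih _ (by omega) _ hE hvE hvdE hge' rfl y hyE hyv
      by_cases hvy : H.Adj v y
      · obtain ⟨l, hl, hlast, hld⟩ := h3 hvy
        have hp := ((hl.mono (Finset.erase_subset _ _)).cons hz
          (fun h => by simpa using hl.2.2 z h) hzy).reverse
        have hh : (z :: y :: l).reverse.head? = some v := by
          rw [List.head?_reverse, List.getLast?_cons_cons, hlast]
        obtain ⟨m, hm⟩ : ∃ m, (z :: y :: l).reverse = v :: m := by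
          cases h : (z :: y :: l).reverse with
          | nil => simp [h] at hh
          | cons a m =>
            rw [h] at hh
            simp only [List.head?_cons, Option.some.injEq] at hh
            exact ⟨m, by rw [hh]⟩
        have hlen := congrArg List.length hm
        simp only [List.length_reverse, List.length_cons] at hlen
        rw [hm] at hp
        exact hvd m hp (by omega)
      · obtain ⟨-, l, hl, hld⟩ := h4 hvy
        have := hA _ ((hl.mono (Finset.erase_subset _ _)).cons hz
          (fun h => by simpa using hl.2.2 z h) hzy)
        simp only [List.length_cons] at this
        omega
    · have hc := card_sdiff_add hYA hYc
      have hvY : v ∉ Y := fun h => by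
        obtain ⟨l, hl, hld⟩ := hYp v h
        exact hvd l hl hld
      have hD : PathsLE H (A \ Y) (d + 1) := hA.mono Finset.sdiff_subset
      have hvD : v ∈ A \ Y := Finset.mem_sdiff.2 ⟨hv, hvY⟩
      have hvdD : ∀ l, IsPathIn H (A \ Y) (v :: l) → l.length ≠ d :=
        fun l hl => hvd l (hl.mono Finset.sdiff_subset)
      have h1 := degSum_closed hYA hY
      have h2 := degSum_le_of_card_eq (H := H) hYc
      have h3 := degSum_add_le (by omega) _ hD hvD hvdD
      intro z hz hzv
      by_cases hzY : z ∈ Y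
      · refine ⟨fun h => absurd (hY z hzY v hv h.symm) hvY, fun _ => ⟨?_, hYp z hzY⟩⟩
        rw [degIn_closed hYA hY hzY]
        by_contra hlt
        have h4 : degSum H Y < ∑ _z ∈ Y, d := by
          refine Finset.sum_lt_sum (fun y hy => ?_) ⟨z, hzY, not_le.1 hlt⟩
          have := degIn_lt (H := H) hy
          omega
        rw [Finset.sum_const, hYc, smul_eq_mul] at h4
        rw [← hc] at hge
        linarith
      · have hzD : z ∈ A \ Y := Finset.mem_sdiff.2 ⟨hz, hzY⟩
        obtain ⟨h4, h5⟩ := ih _ (by omega) _ hD hvD hvdD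
          (by rw [← hc] at hge; linarith) rfl z hzD hzv
        refine ⟨fun h => ?_, fun h => ?_⟩
        · obtain ⟨l, hl, hl'⟩ := h4 h
          exact ⟨l, hl.mono Finset.sdiff_subset, hl'⟩
        · obtain ⟨hdz, l, hl, hl'⟩ := h5 h
          exact ⟨hdz.trans (degIn_sdiff_closed hY hzD).ge, l, hl.mono Finset.sdiff_subset, hl'⟩
    · obtain ⟨e, rfl⟩ := Nat.exists_eq_add_of_le' (show 1 ≤ d by omega)
      have h1 := degSum_le_of_pathsLE e A hA'
      have h2 := degSum_add_card_le (H := H) (A := A)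
      rw [hn] at h1 h2 hge
      have hle : n ≤ e + 1 := by nlinarith
      intro z hz hzv
      have hn2 : 2 ≤ n := by
        rw [← hn]
        exact Finset.one_lt_card.2 ⟨z, hz, v, hv, hzv⟩
      have hne : n = e + 1 := by
        by_contra h
        obtain ⟨m, rfl⟩ := Nat.exists_eq_add_of_le' hn2
        have : m + 2 ≤ e := by omega
        nlinarith
      have hadj := adj_of_degSum_ge (H := H) (A := A) (by rw [hn, hne]; rw [hne] at hge; linarith)
      refine ⟨fun _ => ?_, fun h => absurd (hadj v hv z hz hzv.symm) h⟩
      set L := ((A.erase v).erase z).toList with hL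
      have hzE : z ∈ A.erase v := Finset.mem_erase.2 ⟨hzv, hz⟩
      have hLn : (z :: (L ++ [v])).Nodup := by
        refine List.nodup_cons.2 ⟨by simp [hL, hzv], ?_⟩
        rw [List.nodup_append_comm]
        exact List.nodup_cons.2 ⟨by simp [hL], Finset.nodup_toList _⟩
      have hLA : ∀ x ∈ z :: (L ++ [v]), x ∈ A := by
        intro x hx
        simp only [hL, List.mem_cons, List.mem_append, Finset.mem_toList, Finset.mem_erase,
          List.not_mem_nil, or_false] at hx
        rcases hx with rfl | hx | rfl
        · exact hz
        · exact hx.2.2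
        · exact hv
      refine ⟨L ++ [v], ⟨?_, hLn, hLA⟩, ?_, ?_⟩
      · exact (List.Pairwise.imp_of_mem (fun ha hb hab => hadj _ (hLA _ ha) _ (hLA _ hb) hab)
          hLn).isChain
      · rw [← List.cons_append, List.getLast?_concat]
      · have h3 := Finset.card_erase_add_one hv
        have h4 := Finset.card_erase_add_one hzE
        rw [List.length_append, hL, Finset.length_toList]
        simp only [List.length_singleton]
        omega

lemma pathsLE_of_label {β : Type*} {m : ℕ} (f : V → β) (h : V → ℕ)
    (hf : ∀ x y, H.Adj x y → f x = f y) (hm : ∀ x, h x < m)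
    (hinj : ∀ x y, f x = f y → h x = h y → x = y) : PathsLE H A m := by
  intro l hl
  have hpw : l.Pairwise fun x y => f x = f y := by
    have : l.IsChain fun x y => f x = f y := hl.1.imp hf
    have : IsTrans V fun x y => f x = f y := ⟨fun _ _ _ => Eq.trans⟩
    exact List.isChain_iff_pairwise.1 ‹_›
  have hnd : (l.map h).Nodup := by
    rw [List.Nodup, List.pairwise_map]
    exact (hpw.and hl.2.1).imp fun ⟨h1, h2⟩ h3 => h2 (hinj _ _ h1 h3)
  rw [← List.length_map h, ← List.toFinset_card_of_nodup hnd, ← Finset.card_range m]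
  refine Finset.card_le_card fun n hn => ?_
  obtain ⟨x, -, rfl⟩ := List.mem_map.1 (List.mem_toFinset.1 hn)
  exact Finset.mem_range.2 (hm x)

lemma PathsLE.anti {H' : SimpleGraph V} {m : ℕ} (h : PathsLE H A m) (hle : H' ≤ H) :
    PathsLE H' A m := fun l hl => h l ⟨hl.1.imp fun _ _ hab => hle hab, hl.2⟩

lemma degIn_eq_add_sdiff {R : SimpleGraph V} (hR : R ≤ H) (z : V) :
    degIn H A z = degIn R A z + degIn (H \ R) A z := by
  simp only [degIn, Finset.card_filter, ← Finset.sum_add_distrib, SimpleGraph.sdiff_adj]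
  refine Finset.sum_congr rfl fun u _ => ?_
  have := @hR z u
  split_ifs <;> tauto

lemma degSum_eq_add_sdiff {R : SimpleGraph V} (hR : R ≤ H) :
    degSum H A = degSum R A + degSum (H \ R) A := by
  unfold degSum
  rw [← Finset.sum_add_distrib]
  exact Finset.sum_congr rfl fun z _ => degIn_eq_add_sdiff hR z

lemma IsPathIn.map [Fintype V] {W : Type*} [Fintype W] {H' : SimpleGraph W} {f : V → W}
    (hf : Function.Injective f) (hadj : ∀ x y, H.Adj x y → H'.Adj (f x) (f y)) {l : List V}
    (hl : IsPathIn H Finset.univ l) : IsPathIn H' Finset.univ (l.map f) :=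
  ⟨List.isChain_map_of_isChain f hadj hl.1, hl.2.1.map hf, by simp⟩

lemma PathsLE.comap [Fintype V] {W : Type*} [Fintype W] {H' : SimpleGraph W} {f : V → W} {m : ℕ}
    (hf : Function.Injective f) (hadj : ∀ x y, H.Adj x y → H'.Adj (f x) (f y))
    (h : PathsLE H' Finset.univ m) : PathsLE H Finset.univ m := by
  intro l hl
  simpa using h _ (hl.map hf hadj)

lemma not_hasNPath_succ_iff [Fintype V] {m : ℕ} :
    ¬ HasNPath H (m + 1) ↔ PathsLE H Finset.univ m := by
  constructor
  · intro h l hl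
    by_contra hlt
    have hlt' : m + 1 ≤ l.length := by omega
    have hp := hl.take (m + 1)
    have hlen : (l.take (m + 1)).length = m + 1 := by simpa using hlt'
    have hne : l.take (m + 1) ≠ [] := by
      intro h0; simp [h0] at hlen
    refine h ⟨_, _, SimpleGraph.Walk.ofSupport _ hne hp.1, ?_, ?_⟩
    · rw [SimpleGraph.Walk.isPath_def, SimpleGraph.Walk.support_ofSupport]
      exact hp.2.1
    · rw [SimpleGraph.Walk.length_ofSupport, hlen]
      rfl
  · rintro h ⟨u, w, p, hp, hlen⟩
    have := h p.support ⟨p.isChain_adj_support, hp.support_nodup, by simp⟩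
    rw [SimpleGraph.Walk.length_support] at this
    omega

lemma isPathEndpoint_iff [Fintype V] {v : V} {n : ℕ} :
    IsPathEndpoint H v n ↔ ∃ l, IsPathIn H Finset.univ (v :: l) ∧ l.length + 1 = n := by
  constructor
  · rintro ⟨w, p, hp, hlen⟩
    refine ⟨p.support.tail, ?_, ?_⟩
    · rw [SimpleGraph.Walk.cons_tail_support]
      exact ⟨p.isChain_adj_support, hp.support_nodup, by simp⟩
    · rw [List.length_tail, SimpleGraph.Walk.length_support]
      exact hlen
  · rintro ⟨l, hl, hlen⟩
    have hne : v :: l ≠ [] := List.cons_ne_nil v l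
    obtain ⟨p, hp⟩ : ∃ p : H.Walk v ((v :: l).getLast hne), p.support = v :: l :=
      ⟨SimpleGraph.Walk.ofSupport _ hne hl.1, SimpleGraph.Walk.support_ofSupport _ _⟩
    refine ⟨_, p, ?_, ?_⟩
    · rw [SimpleGraph.Walk.isPath_def, hp]
      exact hl.2.1
    · rw [← SimpleGraph.Walk.length_support, hp]
      exact hlen

/-- The disjoint union of the cliques on the fibres of `f`. -/
def fiberCliques {β : Type*} (f : V → β) : SimpleGraph V where
  Adj x y := x ≠ y ∧ f x = f y
  symm := ⟨fun _ _ h => ⟨h.1.symm, h.2.symm⟩⟩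
  loopless := ⟨fun _ h => h.1 rfl⟩

lemma le_degIn_fiberCliques [Fintype V] {β : Type*} (f : V → β) {m : ℕ} (x : V)
    (g : Fin (m + 1) → V) (hg : Function.Injective g) (hfg : ∀ i, f (g i) = f x) :
    m ≤ degIn (fiberCliques f) Finset.univ x := by
  have hsub : (Finset.univ.image g).erase x ⊆
      Finset.univ.filter ((fiberCliques f).Adj x) := by
    intro y hy
    obtain ⟨hyx, hy⟩ := Finset.mem_erase.1 hy
    obtain ⟨i, -, rfl⟩ := Finset.mem_image.1 hy
    exact Finset.mem_filter.2 ⟨Finset.mem_univ _, hyx.symm, (hfg i).symm⟩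
  have h1 := Finset.card_le_card hsub
  have h2 := Finset.pred_card_le_card_erase (s := Finset.univ.image g) (a := x)
  rw [Finset.card_image_of_injective _ hg, Finset.card_fin] at h2
  exact le_trans (by simpa using h2) h1

lemma le_degSum_of_erase [Fintype V] {m : ℕ} (x : V)
    (h : ∀ y, y ≠ x → m ≤ degIn H Finset.univ y) :
    m * (Fintype.card V - 1) ≤ degSum H Finset.univ := by
  calc m * (Fintype.card V - 1) = ∑ _y ∈ Finset.univ.erase x, m := by
        rw [Finset.sum_const, Finset.card_erase_of_mem (Finset.mem_univ _), smul_eq_mul,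
          Finset.card_univ, Nat.mul_comm]
    _ ≤ ∑ y ∈ Finset.univ.erase x, degIn H Finset.univ y :=
        Finset.sum_le_sum fun y hy => h y (Finset.ne_of_mem_erase hy)
    _ ≤ degSum H Finset.univ :=
        Finset.sum_le_sum_of_subset (Finset.erase_subset _ _)

end PathLists

section RookGadget

variable {c d : ℕ}

/-- Labels of the red cliques (the rows) of the modified rook's graph. -/
def rowLabel : Option (Fin (c + 1) × Fin (d + 1)) → ℕ
  | none => d + 1
  | some (_, j) => j

/-- Labels of the blue cliques (the columns) of the modified rook's graph: the extra vertex
replaces the corner of its column. -/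
def colLabel : Option (Fin (c + 1) × Fin (d + 1)) → ℕ
  | none => 0
  | some (i, j) => if i.val = 0 ∧ j.val = 0 then c + 1 else i

/-- The position of a vertex inside its column. -/
def colPos : Option (Fin (c + 1) × Fin (d + 1)) → ℕ
  | none => 0
  | some (_, j) => j

lemma colLabel_inj (x y : Option (Fin (c + 1) × Fin (d + 1))) (h : colLabel x = colLabel y)
    (h' : colPos x = colPos y) : x = y := by
  rcases x with _ | ⟨i, j⟩ <;> rcases y with _ | ⟨i', j'⟩ <;>
    simp only [colLabel, colPos] at h h'
  · rfl
  · split_ifs at h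
    all_goals omega
  · split_ifs at h
    all_goals omega
  · rw [Fin.ext h']
    split_ifs at h with h1 h2
    · rw [show i = i' from Fin.ext (h1.1.trans h2.1.symm)]
    · omega
    · omega
    · rw [Fin.ext h]

lemma colPos_lt (x : Option (Fin (c + 1) × Fin (d + 1))) : colPos x < d + 1 := by
  rcases x with _ | ⟨i, j⟩
  · exact Nat.succ_pos d
  · exact j.isLt

/-- The rook's graph with `c + 1` columns and `d + 1` rows plus an extra vertex `none` that
replaces the corner `(0, 0)` in its column. -/
def rookGadget (c d : ℕ) : SimpleGraph (Option (Fin (c + 1) × Fin (d + 1))) :=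
  fiberCliques rowLabel ⊔ fiberCliques colLabel

lemma rookGadget_sdiff : rookGadget c d \ fiberCliques rowLabel = fiberCliques colLabel := by
  ext x y
  simp only [rookGadget, SimpleGraph.sdiff_adj, SimpleGraph.sup_adj, fiberCliques]
  constructor
  · tauto
  · rintro ⟨h1, h2⟩
    refine ⟨Or.inr ⟨h1, h2⟩, fun h => h1 ?_⟩
    have h3 := h.2
    rcases x with _ | ⟨i, j⟩ <;> rcases y with _ | ⟨i', j'⟩ <;>
      simp only [rowLabel] at h3
    · rfl
    · omega
    · omega
    · exact colLabel_inj _ _ h2 h3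

lemma le_degSum_rookGadget :
    (c + d) * ((c + 1) * (d + 1)) ≤ degSum (rookGadget c d) Finset.univ := by
  have hcard : Fintype.card (Option (Fin (c + 1) × Fin (d + 1))) - 1 = (c + 1) * (d + 1) := by
    simp
  have hle : fiberCliques rowLabel ≤ rookGadget c d := le_sup_left
  rw [degSum_eq_add_sdiff hle, rookGadget_sdiff, add_mul, ← hcard]
  refine add_le_add (le_degSum_of_erase none fun y hy => ?_)
    (le_degSum_of_erase (some (0, 0)) fun y hy => ?_)
  · obtain ⟨⟨i, j⟩, rfl⟩ := Option.ne_none_iff_exists'.1 hy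
    exact le_degIn_fiberCliques _ _ (fun i' => some (i', j))
      (fun i₁ i₂ h => by simpa using h) fun i' => rfl
  · obtain ⟨i, hi⟩ : ∃ i : Fin (c + 1), colLabel y = i.val := by
      rcases y with _ | ⟨i, j⟩
      · exact ⟨0, rfl⟩
      · refine ⟨i, if_neg fun h => hy ?_⟩
        rw [show i = 0 from Fin.ext h.1, show j = 0 from Fin.ext h.2]
    refine le_degIn_fiberCliques _ _
      (fun j => if i.val = 0 ∧ j.val = 0 then none else some (i, j)) (fun j₁ j₂ h => ?_)
      fun j => ?_
    · have hp : ∀ j : Fin (d + 1), colPos (c := c)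
          (if i.val = 0 ∧ j.val = 0 then none else some (i, j)) = j := by
        intro j
        split_ifs with h
        · exact h.2.symm
        · rfl
      exact Fin.ext (by rw [← hp j₁, ← hp j₂]; exact congrArg colPos h)
    · rw [hi]
      split_ifs with h
      · exact h.1.symm
      · exact if_neg h

lemma not_adj_none_corner : ¬ (rookGadget c d).Adj none (some (0, 0)) := by
  simp [rookGadget, fiberCliques, rowLabel, colLabel]

lemma degIn_corner_le : degIn (rookGadget c d) Finset.univ (some (0, 0)) ≤ c := by
  classical
  have hsub : Finset.univ.filter ((rookGadget c d).Adj (some (0, 0))) ⊆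
      (Finset.univ.erase (0 : Fin (c + 1))).image fun i => some (i, 0) := by
    intro y hy
    have h := (Finset.mem_filter.1 hy).2
    rcases y with _ | ⟨i, j⟩
    · exact absurd h.symm not_adj_none_corner
    · rcases h with ⟨h1, h2⟩ | ⟨h1, h2⟩
      · have hj : j = 0 := (Fin.ext h2).symm
        subst hj
        refine Finset.mem_image.2 ⟨i, Finset.mem_erase.2 ⟨?_, Finset.mem_univ _⟩, rfl⟩
        rintro rfl
        exact h1 rfl
      · simp only [colLabel] at h2
        rw [if_pos ⟨rfl, rfl⟩] at h2
        split_ifs at h2 with h3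
        · exact absurd (by rw [show i = 0 from Fin.ext h3.1, show j = 0 from Fin.ext h3.2]) h1
        · omega
  calc degIn (rookGadget c d) Finset.univ (some (0, 0))
      ≤ ((Finset.univ.erase (0 : Fin (c + 1))).image fun i => some (i, (0 : Fin (d + 1)))).card := by
        rw [degIn]; convert Finset.card_le_card hsub
    _ ≤ (Finset.univ.erase (0 : Fin (c + 1))).card := Finset.card_image_le
    _ = c := by simp

/-- In every good coloring of the gadget the extra vertex starts a blue path on `d + 1`
vertices. -/
lemma exists_blue_path_of_rookGadget (hc : 1 ≤ c) (hcd : c < d) (hd : 3 ≤ d)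
    {R : SimpleGraph (Option (Fin (c + 1) × Fin (d + 1)))} (hR : R ≤ rookGadget c d)
    (hred : PathsLE R Finset.univ (c + 1))
    (hblue : PathsLE (rookGadget c d \ R) Finset.univ (d + 1)) :
    ∃ l, IsPathIn (rookGadget c d \ R) Finset.univ (none :: l) ∧ l.length = d := by
  by_contra! hcon
  have hcard : (Finset.univ : Finset (Option (Fin (c + 1) × Fin (d + 1)))).card
      = (c + 1) * (d + 1) + 1 := by simp
  have h1 := le_degSum_rookGadget (c := c) (d := d)
  rw [degSum_eq_add_sdiff hR] at h1
  have h2 := mt (dvd_card_of_lt_degSum hc _ hred) (by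
    rw [hcard, Nat.dvd_add_right (dvd_mul_right _ _), Nat.dvd_one]
    omega)
  rw [hcard] at h2
  have h3 := structure_of_degSum_add_ge hd _ hblue (Finset.mem_univ none) hcon (by
    rw [hcard]
    nlinarith) (some (0, 0)) (Finset.mem_univ _) (by simp)
  have h4 := (h3.2 fun h => not_adj_none_corner h.1).1
  have h5 := degIn_corner_le (c := c) (d := d)
  rw [degIn_eq_add_sdiff hR] at h5
  omega

end RookGadget

section Transmitter

variable {c d n : ℕ}

/-- The vertices of the transmitter: a spine on `n + 1` vertices, and `c` copies of the gadget for
each of them. -/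
abbrev TransmitterVertex (c d n : ℕ) : Type :=
  Fin (n + 1) ⊕ (Fin (n + 1) × Fin c × Option (Fin (c + 1) × Fin (d + 1)))

/-- The red edges of the standard coloring of the transmitter: the rows of the gadgets, and, for
each vertex of the spine other than the first one, a path through the extra vertices of its
gadgets. -/
def redRel : TransmitterVertex c d n → TransmitterVertex c d n → Prop
  | .inl i, .inr (i', j, g) => i = i' ∧ 0 < i.val ∧ j.val = 0 ∧ g = none
  | .inr (i, j, g), .inr (i', j', g') => i = i' ∧
      (j = j' ∧ (fiberCliques rowLabel).Adj g g' ∨ j.val + 1 = j'.val ∧ g = none ∧ g' = none)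
  | _, _ => False

/-- The blue edges of the standard coloring of the transmitter: the spine and the columns of the
gadgets. -/
def blueRel : TransmitterVertex c d n → TransmitterVertex c d n → Prop
  | .inl i, .inl i' => i.val + 1 = i'.val
  | .inr (i, j, g), .inr (i', j', g') => i = i' ∧ j = j' ∧ (fiberCliques colLabel).Adj g g'
  | _, _ => False

/-- The transmitter, with the first vertex `Sum.inl 0` of the spine as its special vertex. -/
def transmitter (c d n : ℕ) : SimpleGraph (TransmitterVertex c d n) :=
  SimpleGraph.fromRel redRel ⊔ SimpleGraph.fromRel blueRel

lemma pathsLE_fromRel_redRel :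
    PathsLE (SimpleGraph.fromRel (redRel (c := c) (d := d) (n := n))) Finset.univ (c + 1) := by
  let f : TransmitterVertex c d n → ℕ × ℕ × ℕ
    | .inl i => (i, 0, 0)
    | .inr (i, _, none) => (i, 0, 0)
    | .inr (i, j, some (_, q)) => (i, j + 1, q)
  let h : TransmitterVertex c d n → ℕ
    | .inl _ => 0
    | .inr (_, j, none) => j + 1
    | .inr (_, _, some (p, _)) => p
  have hf : ∀ a b, redRel a b → f a = f b := by
    rintro (i | ⟨i, j, _ | ⟨p, q⟩⟩) (i' | ⟨i', j', _ | ⟨p', q'⟩⟩) hab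
    · exact hab.elim
    · obtain ⟨rfl, -⟩ := hab
      rfl
    · cases hab.2.2.2
    · exact hab.elim
    · obtain ⟨rfl, -⟩ := hab
      rfl
    · rcases hab.2 with ⟨-, -, hq⟩ | ⟨-, -, hq⟩
      · exact absurd hq q'.isLt.ne'
      · cases hq
    · exact hab.elim
    · rcases hab.2 with ⟨-, -, hq⟩ | ⟨-, hq, -⟩
      · exact absurd hq q.isLt.ne
      · cases hq
    · rcases hab with ⟨rfl, ⟨rfl, -, hq⟩ | ⟨-, hq, -⟩⟩
      · exact congrArg (fun t => (i.val, j.val + 1, t)) hq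
      · cases hq
  refine pathsLE_of_label f h ?_ ?_ ?_
  · rintro a b ⟨-, hab | hab⟩
    · exact hf a b hab
    · exact (hf b a hab).symm
  · rintro (i | ⟨i, j, _ | ⟨p, q⟩⟩)
    · exact Nat.succ_pos c
    · exact Nat.succ_lt_succ j.isLt
    · exact p.isLt
  · rintro (i | ⟨i, j, _ | ⟨p, q⟩⟩) (i' | ⟨i', j', _ | ⟨p', q'⟩⟩) hab hab' <;>
      simp only [f, h, Prod.mk.injEq] at hab hab'
    · rw [Fin.ext hab.1]
    · omega
    · omega
    · omega
    · rw [Fin.ext hab.1, show j = j' from Fin.ext (Nat.succ_injective hab')]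
    · omega
    · omega
    · omega
    · rw [Fin.ext hab.1, show j = j' from Fin.ext (Nat.succ_injective hab.2.1), Fin.ext hab.2.2,
        Fin.ext hab']

lemma pathsLE_fromRel_blueRel (hn : n ≤ d) :
    PathsLE (SimpleGraph.fromRel (blueRel (c := c) (d := d) (n := n))) Finset.univ (d + 1) := by
  let f : TransmitterVertex c d n → ℕ × ℕ × ℕ
    | .inl _ => (0, 0, 0)
    | .inr (i, j, g) => (i + 1, j, colLabel g)
  let h : TransmitterVertex c d n → ℕ
    | .inl i => i
    | .inr (_, _, g) => colPos g
  have hf : ∀ a b, blueRel a b → f a = f b := by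
    rintro (i | ⟨i, j, g⟩) (i' | ⟨i', j', g'⟩) hab
    · rfl
    · exact hab.elim
    · exact hab.elim
    · obtain ⟨rfl, rfl, -, hg⟩ := hab
      exact congrArg (fun t => (i.val + 1, j.val, t)) hg
  refine pathsLE_of_label f h ?_ ?_ ?_
  · rintro a b ⟨-, hab | hab⟩
    · exact hf a b hab
    · exact (hf b a hab).symm
  · rintro (i | ⟨i, j, g⟩)
    · exact lt_of_lt_of_le i.isLt (Nat.succ_le_succ hn)
    · exact colPos_lt g
  · rintro (i | ⟨i, j, g⟩) (i' | ⟨i', j', g'⟩) hab hab'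
    · exact congrArg Sum.inl (Fin.ext hab')
    · simp [f] at hab
    · simp [f] at hab
    · simp only [f, h, Prod.mk.injEq] at hab hab'
      rw [show i = i' from Fin.ext (Nat.succ_injective hab.1), show j = j' from Fin.ext hab.2.1,
        colLabel_inj g g' hab.2.2 hab']

lemma transmitter_adj_copy {i : Fin (n + 1)} {j : Fin c}
    {g g' : Option (Fin (c + 1) × Fin (d + 1))} :
    (transmitter c d n).Adj (.inr (i, j, g)) (.inr (i, j, g')) ↔ (rookGadget c d).Adj g g' := by
  simp only [transmitter, rookGadget, SimpleGraph.sup_adj, SimpleGraph.fromRel_adj, redRel,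
    blueRel, fiberCliques, ne_eq, Sum.inr.injEq, Prod.mk.injEq, true_and,
    Nat.succ_ne_self, false_and, or_false]
  tauto

lemma transmitter_adj_inl {i : Fin (n + 1)} {w : TransmitterVertex c d n}
    (h : (transmitter c d n).Adj (.inl i) w) :
    (∃ i', w = .inl i' ∧ (i.val + 1 = i'.val ∨ i'.val + 1 = i.val)) ∨
      0 < i.val ∧ ∃ j, w = .inr (i, j, none) := by
  rcases w with i' | ⟨i', j, g⟩
  · refine Or.inl ⟨i', rfl, ?_⟩
    simpa [transmitter, redRel, blueRel] using h.imp And.right And.right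
  · refine Or.inr ?_
    simp [transmitter, redRel, blueRel] at h
    obtain ⟨rfl, h1, -, rfl⟩ := h
    exact ⟨h1, j, rfl⟩

section Forcing

variable {R : SimpleGraph (TransmitterVertex c d n)} (hc : 1 ≤ c) (hcd : c < d) (hd : 3 ≤ d)
  (hR : R ≤ transmitter c d n) (hred : PathsLE R Finset.univ (c + 1))
  (hblue : PathsLE (transmitter c d n \ R) Finset.univ (d + 1))

include hc hcd hd hR hred hblue

/-- Every edge leaving a copy of the gadget at its extra vertex is red. -/
lemma red_of_adj_extra {i : Fin (n + 1)} {j : Fin c} {w : TransmitterVertex c d n}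
    (hw : ∀ g, w ≠ .inr (i, j, g)) (h : (transmitter c d n).Adj w (.inr (i, j, none))) :
    R.Adj w (.inr (i, j, none)) := by
  by_contra hwR
  let ι : Option (Fin (c + 1) × Fin (d + 1)) → TransmitterVertex c d n := fun g => .inr (i, j, g)
  have hι : Function.Injective ι := fun g g' h => by simpa [ι] using h
  have hadj : ∀ g g', (rookGadget c d \ R.comap ι).Adj g g' →
      (transmitter c d n \ R).Adj (ι g) (ι g') :=
    fun g g' h => ⟨transmitter_adj_copy.2 h.1, h.2⟩
  obtain ⟨l, hl, hlen⟩ := exists_blue_path_of_rookGadget hc hcd hd (R := R.comap ι)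
    (fun g g' h => transmitter_adj_copy.1 (hR h)) (hred.comap hι fun _ _ h => h)
    (hblue.comap hι hadj)
  have hl' := hblue _ (((hl.map hι hadj).cons (Finset.mem_univ w)
    (fun hmem => by
      obtain ⟨g, -, hg⟩ := List.mem_map.1 (by rwa [List.map_cons] : w ∈ (none :: l).map ι)
      exact hw g hg.symm) ⟨h, hwR⟩))
  simp [hlen] at hl'

lemma isPathIn_extras {i : Fin (n + 1)} (hi : 0 < i.val) :
    IsPathIn R Finset.univ
      (.inl i :: (List.finRange c).map fun j => .inr (i, j, none)) := by
  refine ⟨?_, ?_, by simp⟩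
  · rw [List.isChain_iff_getElem]
    intro m hm
    simp only [List.length_cons, List.length_map, List.length_finRange] at hm
    rcases m with _ | m
    · simp only [List.getElem_cons_zero, List.getElem_cons_succ, List.getElem_map,
        List.getElem_finRange]
      refine red_of_adj_extra hc hcd hd hR hred hblue (by simp) ?_
      simp [transmitter, redRel, hi]
    · simp only [List.getElem_cons_succ, List.getElem_map, List.getElem_finRange]
      refine red_of_adj_extra hc hcd hd hR hred hblue (by simp) ?_
      simp [transmitter, redRel]
  · rw [List.nodup_cons]
    refine ⟨by simp, (List.nodup_finRange c).map fun j j' h => ?_⟩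
    simpa using h

lemma not_red_spine {i i' : Fin (n + 1)} (hii : i.val + 1 = i'.val) :
    ¬ R.Adj (.inl i) (.inl i') := by
  intro h
  have hl := hred _ ((isPathIn_extras hc hcd hd hR hred hblue (i := i') (by omega)).cons
    (Finset.mem_univ (.inl i)) (by simp [Fin.ext_iff]; omega) h)
  simp at hl

lemma blue_neighbor_inl {i : Fin (n + 1)} {w : TransmitterVertex c d n}
    (h : (transmitter c d n \ R).Adj (.inl i) w) : ∃ i', w = .inl i' := by
  rcases transmitter_adj_inl h.1 with ⟨i', hw, -⟩ | ⟨-, j, rfl⟩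
  · exact ⟨i', hw⟩
  · exact absurd (red_of_adj_extra hc hcd hd hR hred hblue (by simp) h.1) h.2

lemma length_blue_path_inl_le {i : Fin (n + 1)} {l : List (TransmitterVertex c d n)}
    (hl : IsPathIn (transmitter c d n \ R) Finset.univ (.inl i :: l)) : l.length ≤ n := by
  have hmem : ∀ (l : List (TransmitterVertex c d n)) (i : Fin (n + 1)),
      (.inl i :: l).IsChain (transmitter c d n \ R).Adj →
      ∀ y ∈ (.inl i :: l : List (TransmitterVertex c d n)), ∃ i', y = .inl i' := by
    intro l
    induction l with
    | nil => simp
    | cons w l ih =>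
      intro i h y hy
      rw [List.isChain_cons_cons] at h
      obtain ⟨i', rfl⟩ := blue_neighbor_inl hc hcd hd hR hred hblue h.1
      rcases List.mem_cons.1 hy with rfl | hy
      · exact ⟨i, rfl⟩
      · exact ih i' h.2 y hy
  have hcard := Finset.card_le_card (s := (.inl i :: l).toFinset)
    (t := (Finset.univ : Finset (Fin (n + 1))).image .inl) fun y hy => by
      obtain ⟨i', rfl⟩ := hmem l i hl.1 y (List.mem_toFinset.1 hy)
      exact Finset.mem_image_of_mem _ (Finset.mem_univ i')
  rw [List.toFinset_card_of_nodup hl.2.1] at hcard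
  simpa using hcard.trans Finset.card_image_le

lemma isPathIn_spine : IsPathIn (transmitter c d n \ R) Finset.univ
    (.inl 0 :: (List.finRange n).map fun i => .inl i.succ) := by
  have h : IsPathIn (transmitter c d n \ R) Finset.univ ((List.finRange (n + 1)).map .inl) := by
    refine ⟨?_, (List.nodup_finRange _).map Sum.inl_injective, by simp⟩
    rw [List.isChain_iff_getElem]
    intro m hm
    simp only [List.getElem_map, List.getElem_finRange]
    refine ⟨?_, not_red_spine hc hcd hd hR hred hblue rfl⟩
    simp [transmitter, blueRel]
  simpa [List.finRange_succ, Function.comp_def] using h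

lemma not_red_inl_zero (w : TransmitterVertex c d n) : ¬ R.Adj (.inl 0) w := by
  intro h
  rcases transmitter_adj_inl (hR h) with ⟨i', rfl, hi | hi⟩ | ⟨h0, -⟩
  · exact not_red_spine hc hcd hd hR hred hblue hi h
  · simp at hi
  · simp at h0

end Forcing

end Transmitter

lemma goodColoring_iff {V : Type*} [Fintype V] {G R : SimpleGraph V} {a b : ℕ} :
    GoodColoring G R (a + 1) (b + 1) ↔
      R ≤ G ∧ PathsLE R Finset.univ a ∧ PathsLE (G \ R) Finset.univ b := by
  rw [GoodColoring, not_hasNPath_succ_iff, not_hasNPath_succ_iff]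

lemma goodColoring_comap {V W : Type*} [Fintype V] [Fintype W] (e : V ≃ W) {G R : SimpleGraph W}
    {a b : ℕ} (h : GoodColoring G R (a + 1) (b + 1)) :
    GoodColoring (G.comap e) (R.comap e) (a + 1) (b + 1) := by
  rw [goodColoring_iff] at h ⊢
  exact ⟨fun _ _ hxy => h.1 hxy, h.2.1.comap e.injective fun _ _ hxy => hxy,
    h.2.2.comap e.injective fun _ _ hxy => hxy⟩

lemma isGood_transmitter {c d n : ℕ} (hn : n ≤ d) :
    IsGood (transmitter c d n) (c + 2) (d + 2) := by
  refine ⟨SimpleGraph.fromRel redRel, goodColoring_iff.2 ⟨le_sup_left, pathsLE_fromRel_redRel,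
    (pathsLE_fromRel_blueRel hn).anti ?_⟩⟩
  rintro x y ⟨h | h, h'⟩
  · exact absurd h h'
  · exact h

lemma transmitter_spec {c d n : ℕ} (hc : 1 ≤ c) (hcd : c < d) (hd : 3 ≤ d)
    {R : SimpleGraph (TransmitterVertex c d n)}
    (h : GoodColoring (transmitter c d n) R (c + 2) (d + 2)) :
    StrictEndpoint (transmitter c d n \ R) (.inl 0) (n + 1) ∧ ∀ u, ¬ R.Adj (.inl 0) u := by
  obtain ⟨hR, hred, hblue⟩ := goodColoring_iff.1 h
  refine ⟨⟨?_, fun y hy => ?_⟩, not_red_inl_zero hc hcd hd hR hred hblue⟩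
  · exact isPathEndpoint_iff.2 ⟨_, isPathIn_spine hc hcd hd hR hred hblue, by simp⟩
  · obtain ⟨l, hl, rfl⟩ := isPathEndpoint_iff.1 hy
    exact Nat.succ_le_succ (length_blue_path_inl_le hc hcd hd hR hred hblue hl)

lemma IsPathEndpoint.map {V W : Type*} [Fintype V] [Fintype W] {H : SimpleGraph V}
    {H' : SimpleGraph W} {f : V → W} (hf : Function.Injective f)
    (hadj : ∀ x y, H.Adj x y → H'.Adj (f x) (f y)) {v : V} {m : ℕ} (h : IsPathEndpoint H v m) :
    IsPathEndpoint H' (f v) m := by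
  obtain ⟨l, hl, hlen⟩ := isPathEndpoint_iff.1 h
  exact isPathEndpoint_iff.2 ⟨l.map f, by simpa using hl.map hf hadj, by simpa using hlen⟩

/-- for 3 ≤ k < ℓ (with ℓ ≥ 5 when k = 3) and 2 ≤ x ≤ ℓ−1 there exists a
(k, ℓ, x)-blue-transmitter. -/
theorem stmt5 (k ℓ x : ℕ) (hk : 3 ≤ k) (hkl : k < ℓ) (h3 : k = 3 → 5 ≤ ℓ)
    (hx2 : 2 ≤ x) (hxℓ : x ≤ ℓ - 1) :
    ∃ (n : ℕ) (G : SimpleGraph (Fin n)) (v : Fin n),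
      IsGood G k ℓ ∧
      ∀ R : SimpleGraph (Fin n), GoodColoring G R k ℓ →
        StrictEndpoint (G \ R) v x ∧ ∀ u, ¬ R.Adj v u := by

  obtain ⟨c, rfl⟩ := Nat.exists_eq_add_of_le' (show 2 ≤ k by omega)
  obtain ⟨d, rfl⟩ := Nat.exists_eq_add_of_le' (show 2 ≤ ℓ by omega)
  obtain ⟨n, rfl⟩ := Nat.exists_eq_add_of_le' (show 1 ≤ x by omega)
  let e := Fintype.equivFin (TransmitterVertex c d n)
  refine ⟨_, (transmitter c d n).comap e.symm, e (.inl 0), ?_, fun R hR => ?_⟩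
  · obtain ⟨R, hR⟩ := isGood_transmitter (c := c) (show n ≤ d by omega)
    exact ⟨_, goodColoring_comap e.symm hR⟩
  · have hG : ((transmitter c d n).comap e.symm).comap e = transmitter c d n := by
      ext x y
      simp
    have h := goodColoring_comap e hR
    rw [hG] at h
    obtain ⟨⟨h1, h2⟩, h3⟩ := transmitter_spec (by omega) (by omega) (by omega) h
    refine ⟨⟨h1.map e.injective fun x y hxy => ?_, fun y hy => h2 y ?_⟩, fun u hu => ?_⟩
    · simpa using hxy
    · have := hy.map (H' := transmitter c d n \ R.comap e) e.symm.injective fun x y hxy => by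
        simpa using hxy
      simpa using this
    · exact h3 (e.symm u) (by simpa using hu)
end
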